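/- arXiv:1601.00325 — 3 statements merged into one kernel-verified Lean document; each statement's English description precedes it below -/
import Mathlib

section
/- Let n ≥ 3 be a natural number and let φ : ℝⁿ → ℝ be a smooth function with compact support. Then ((n−2)/2)² · ∫_{ℝⁿ} φ(x)²/‖x‖² dx ≤ ∫_{ℝⁿ} ‖∇φ(x)‖² dx, where ∇φ is the gradient (total derivative) of φ and the integrals are with respect to Lebesgue measure. -/
open MeasureTheory

/-- The radial field `x / (‖x‖² + ε)`, read in the coordinate `i`. -/
noncomputable def regField {n : ℕ} (ε : ℝ) (i : Fin n) (x : EuclideanSpace ℝ (Fin n)) : ℝ :=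
  x i / (‖x‖ ^ 2 + ε)

lemma contDiff_regField {n : ℕ} {ε : ℝ} (hε : 0 < ε) (i : Fin n) :
    ContDiff ℝ 1 (regField ε i) := by
  unfold regField
  refine ContDiff.div ?_ ?_ fun x => by positivity
  · exact (EuclideanSpace.proj (𝕜 := ℝ) i).contDiff
  · exact (contDiff_norm_sq ℝ).add contDiff_const

lemma fderiv_regField_single {n : ℕ} {ε : ℝ} (hε : 0 < ε) (i : Fin n)
    (x : EuclideanSpace ℝ (Fin n)) :
    fderiv ℝ (regField ε i) x (EuclideanSpace.single i 1) =
      1 / (‖x‖ ^ 2 + ε) - 2 * x i ^ 2 / (‖x‖ ^ 2 + ε) ^ 2 := by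
  have hne : ‖x‖ ^ 2 + ε ≠ 0 := by positivity
  have h1 : HasFDerivAt (fun x : EuclideanSpace ℝ (Fin n) => x i)
      (EuclideanSpace.proj (𝕜 := ℝ) i) x := (EuclideanSpace.proj (𝕜 := ℝ) i).hasFDerivAt
  have h2 := ((hasStrictFDerivAt_norm_sq x).hasFDerivAt).add_const ε
  have h3 := h1.mul ((hasDerivAt_inv hne).comp_hasFDerivAt x h2)
  have h4 : HasFDerivAt (regField ε i) _ x := h3
  rw [h4.fderiv]
  simp [EuclideanSpace.inner_single_right]
  field_simp
  ring

/-- The divergence of the field `x / (‖x‖² + ε)`. -/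
lemma sum_fderiv_regField {n : ℕ} {ε : ℝ} (hε : 0 < ε) (x : EuclideanSpace ℝ (Fin n)) :
    ∑ i, fderiv ℝ (regField ε i) x (EuclideanSpace.single i 1) =
      n / (‖x‖ ^ 2 + ε) - 2 * ‖x‖ ^ 2 / (‖x‖ ^ 2 + ε) ^ 2 := by
  simp_rw [fderiv_regField_single hε]
  rw [Finset.sum_sub_distrib, ← Finset.sum_div, ← Finset.sum_div, ← Finset.mul_sum,
    ← EuclideanSpace.real_norm_sq_eq]
  simp [div_eq_mul_inv]

lemma sum_map_single_mul_regField {n : ℕ} (ε : ℝ) (L : EuclideanSpace ℝ (Fin n) →L[ℝ] ℝ)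
    (x : EuclideanSpace ℝ (Fin n)) :
    ∑ i, L (EuclideanSpace.single i 1) * regField ε i x = L x / (‖x‖ ^ 2 + ε) := by
  have hx : L x = ∑ i, x i * L (EuclideanSpace.single i 1) := by
    conv_lhs => rw [← (EuclideanSpace.basisFun (Fin n) ℝ).sum_repr x]
    simp
  rw [hx, Finset.sum_div]
  refine Finset.sum_congr rfl fun i _ => ?_
  rw [regField]
  ring

/-- The divergence of `φ² x / (‖x‖² + ε)` is integrable, with integral zero. -/
lemma integral_divergence_sq_mul_regField {n : ℕ} {ε : ℝ} (hε : 0 < ε)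
    {φ : EuclideanSpace ℝ (Fin n) → ℝ} (hφ : ContDiff ℝ 1 φ) (hsupp : HasCompactSupport φ) :
    let F := fun x => φ x ^ 2 * (n / (‖x‖ ^ 2 + ε) - 2 * ‖x‖ ^ 2 / (‖x‖ ^ 2 + ε) ^ 2) +
      2 * φ x * fderiv ℝ φ x x / (‖x‖ ^ 2 + ε)
    Integrable F ∧ ∫ x, F x = 0 := by
  intro F
  let f : EuclideanSpace ℝ (Fin n) → ℝ := fun x => φ x ^ 2
  have hf : ContDiff ℝ 1 f := hφ.pow 2
  have hfs : HasCompactSupport f := hsupp.comp_left (g := fun t : ℝ => t ^ 2) (by simp)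
  have hdf : ∀ x, fderiv ℝ f x = (2 * φ x) • fderiv ℝ φ x := fun x => by
    have := ((hφ.differentiable one_ne_zero x).hasFDerivAt.pow 2).fderiv
    simpa using this
  have hI1 : ∀ i, Integrable fun x =>
      fderiv ℝ f x (EuclideanSpace.single i 1) * regField ε i x := fun i =>
    (((hf.continuous_fderiv one_ne_zero).clm_apply continuous_const).mul
      (contDiff_regField hε i).continuous).integrable_of_hasCompactSupport
      ((hfs.fderiv_apply ℝ _).mul_right)
  have hI2 : ∀ i, Integrable fun x =>
      f x * fderiv ℝ (regField ε i) x (EuclideanSpace.single i 1) := fun i =>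
    (hf.continuous.mul (((contDiff_regField hε i).continuous_fderiv one_ne_zero).clm_apply
      continuous_const)).integrable_of_hasCompactSupport hfs.mul_right
  have hI3 : ∀ i, Integrable fun x => f x * regField ε i x := fun i =>
    (hf.continuous.mul (contDiff_regField hε i).continuous).integrable_of_hasCompactSupport
      hfs.mul_right
  have hF : F = fun x => ∑ i, (f x * fderiv ℝ (regField ε i) x (EuclideanSpace.single i 1) +
      fderiv ℝ f x (EuclideanSpace.single i 1) * regField ε i x) := by
    funext x
    rw [Finset.sum_add_distrib, ← Finset.mul_sum, sum_fderiv_regField hε,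
      sum_map_single_mul_regField, hdf]
    simp [F, f]
  rw [hF]
  refine ⟨integrable_finsetSum _ fun i _ => (hI2 i).add (hI1 i), ?_⟩
  refine (integral_finsetSum _ fun i _ => (hI2 i).add (hI1 i)).trans ?_
  refine Finset.sum_eq_zero fun i _ => ?_
  rw [integral_add' (hI2 i) (hI1 i), integral_mul_fderiv_eq_neg_fderiv_mul_of_integrable (hI1 i)
    (hI2 i) (hI3 i) (fun x _ => hf.differentiable one_ne_zero x)
    (fun x _ => (contDiff_regField hε i).differentiable one_ne_zero x), neg_add_cancel]

/-- The pointwise inequality behind Hardy's inequality: `a = φ`, `d = ‖∇φ‖`, `b = x · ∇φ`. -/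
lemma hardy_pointwise {m ε r a b d : ℝ} (hm : 2 ≤ m) (hε : 0 < ε) (hb : b ^ 2 ≤ d ^ 2 * r ^ 2) :
    ((m - 2) / 2) ^ 2 * (a ^ 2 / (r ^ 2 + ε)) ≤ d ^ 2 + (m - 2) / 2 *
      (a ^ 2 * (m / (r ^ 2 + ε) - 2 * r ^ 2 / (r ^ 2 + ε) ^ 2) + 2 * a * b / (r ^ 2 + ε)) := by
  have hs : 0 < r ^ 2 + ε := by positivity
  obtain ⟨c, rfl⟩ : ∃ c, m = 2 * c + 2 := ⟨(m - 2) / 2, by ring⟩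
  have hc : 0 ≤ c := by linarith
  have hsq : b ^ 2 / (r ^ 2 + ε) ≤ d ^ 2 := by
    rw [div_le_iff₀ hs]
    nlinarith [mul_nonneg (sq_nonneg d) hε.le]
  have key : d ^ 2 + (2 * c + 2 - 2) / 2 *
      (a ^ 2 * ((2 * c + 2) / (r ^ 2 + ε) - 2 * r ^ 2 / (r ^ 2 + ε) ^ 2) +
        2 * a * b / (r ^ 2 + ε)) - ((2 * c + 2 - 2) / 2) ^ 2 * (a ^ 2 / (r ^ 2 + ε)) =
      (d ^ 2 - b ^ 2 / (r ^ 2 + ε)) + (c * a + b) ^ 2 / (r ^ 2 + ε) +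
        2 * c * a ^ 2 * ε / (r ^ 2 + ε) ^ 2 := by
    field_simp
    ring
  have h1 : 0 ≤ (c * a + b) ^ 2 / (r ^ 2 + ε) := by positivity
  have h2 : 0 ≤ 2 * c * a ^ 2 * ε / (r ^ 2 + ε) ^ 2 := by positivity
  linarith

lemma hardy_regularized {n : ℕ} (hn : 2 ≤ n) {ε : ℝ} (hε : 0 < ε)
    {φ : EuclideanSpace ℝ (Fin n) → ℝ} (hφ : ContDiff ℝ 1 φ) (hsupp : HasCompactSupport φ) :
    (((n : ℝ) - 2) / 2) ^ 2 * ∫ x, φ x ^ 2 / (‖x‖ ^ 2 + ε) ≤ ∫ x, ‖fderiv ℝ φ x‖ ^ 2 := by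
  obtain ⟨hF, hF0⟩ := integral_divergence_sq_mul_regField hε hφ hsupp
  have hG : Integrable fun x => ‖fderiv ℝ φ x‖ ^ 2 := by
    have hs : HasCompactSupport fun x => ‖fderiv ℝ φ x‖ := (hsupp.fderiv ℝ).norm
    have hs2 : HasCompactSupport fun x => ‖fderiv ℝ φ x‖ ^ 2 := by
      simp_rw [sq]
      exact hs.mul_left
    exact ((hφ.continuous_fderiv one_ne_zero).norm.pow 2).integrable_of_hasCompactSupport hs2
  have hH : Integrable fun x => φ x ^ 2 / (‖x‖ ^ 2 + ε) := by
    refine Continuous.integrable_of_hasCompactSupport ?_ ?_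
    · exact (hφ.continuous.pow 2).div (by fun_prop) fun x => by positivity
    · simp_rw [div_eq_mul_inv]
      exact HasCompactSupport.mul_right
        (hsupp.comp_left (g := fun t : ℝ => t ^ 2) (by simp))
  have hle : ∀ x, (fderiv ℝ φ x x) ^ 2 ≤ ‖fderiv ℝ φ x‖ ^ 2 * ‖x‖ ^ 2 := fun x => by
    rw [← mul_pow]
    exact sq_le_sq' (neg_le_of_abs_le ((fderiv ℝ φ x).le_opNorm x))
      (le_of_abs_le ((fderiv ℝ φ x).le_opNorm x))
  have hn' : (2 : ℝ) ≤ n := by exact_mod_cast hn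
  calc (((n : ℝ) - 2) / 2) ^ 2 * ∫ x, φ x ^ 2 / (‖x‖ ^ 2 + ε)
      = ∫ x, (((n : ℝ) - 2) / 2) ^ 2 * (φ x ^ 2 / (‖x‖ ^ 2 + ε)) :=
        (integral_const_mul _ _).symm
    _ ≤ ∫ x, (‖fderiv ℝ φ x‖ ^ 2 + ((n : ℝ) - 2) / 2 *
          (φ x ^ 2 * (n / (‖x‖ ^ 2 + ε) - 2 * ‖x‖ ^ 2 / (‖x‖ ^ 2 + ε) ^ 2) +
            2 * φ x * fderiv ℝ φ x x / (‖x‖ ^ 2 + ε))) :=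
        integral_mono (hH.const_mul _) (hG.add (hF.const_mul _)) fun x =>
          hardy_pointwise hn' hε (hle x)
    _ = ∫ x, ‖fderiv ℝ φ x‖ ^ 2 := by
        rw [integral_add hG (hF.const_mul _), integral_const_mul, hF0, mul_zero, add_zero]

theorem stmt_11 (n : ℕ) (hn : 3 ≤ n)
    (φ : EuclideanSpace ℝ (Fin n) → ℝ)
    (hφ : ContDiff ℝ (⊤ : ℕ∞) φ) (hsupp : HasCompactSupport φ) :
    (((n : ℝ) - 2) / 2) ^ 2 * ∫ x, φ x ^ 2 / ‖x‖ ^ 2 ≤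
      ∫ x, ‖fderiv ℝ φ x‖ ^ 2 := by
  have hφ1 : ContDiff ℝ 1 φ := hφ.of_le (by exact_mod_cast le_top)
  by_cases hint : Integrable fun x => φ x ^ 2 / ‖x‖ ^ 2
  · have : Nonempty (Fin n) := ⟨⟨0, by omega⟩⟩
    have hne : ∀ᵐ x : EuclideanSpace ℝ (Fin n), x ≠ 0 := Measure.ae_ne volume 0
    have hlim : Filter.Tendsto (fun ε : ℝ => ∫ x, φ x ^ 2 / (‖x‖ ^ 2 + ε))
        (nhdsWithin 0 (Set.Ioi 0)) (nhds (∫ x, φ x ^ 2 / ‖x‖ ^ 2)) := by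
      refine tendsto_integral_filter_of_dominated_convergence _ ?_ ?_ hint ?_
      · filter_upwards [self_mem_nhdsWithin] with ε hε
        have hε : 0 < ε := hε
        exact ((hφ1.continuous.pow 2).div (by fun_prop) fun x => by
          positivity).aestronglyMeasurable
      · filter_upwards [self_mem_nhdsWithin] with ε hε
        have hε : 0 < ε := hε
        filter_upwards [hne] with x hx
        have hx : 0 < ‖x‖ := norm_pos_iff.mpr hx
        rw [Real.norm_of_nonneg (by positivity)]
        gcongr
        linarith
      · filter_upwards [hne] with x hx
        have hx : ‖x‖ ^ 2 + 0 ≠ 0 := by simpa using hx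
        have : ContinuousAt (fun ε : ℝ => φ x ^ 2 / (‖x‖ ^ 2 + ε)) 0 :=
          continuousAt_const.div (by fun_prop) hx
        simpa using this.tendsto.mono_left nhdsWithin_le_nhds
    refine le_of_tendsto (hlim.const_mul _) ?_
    filter_upwards [self_mem_nhdsWithin] with ε hε
    exact hardy_regularized (by omega) hε hφ1 hsupp
  · rw [integral_undef hint, mul_zero]
    positivity
end

section
/- Let (Z, μ) be a measure space, let F, G, a, b : Z → [0, ∞) be measurable functions, let L ≥ 0 be a real number with a(z) + b(z) ≥ L for all z ∈ Z, and let D > 0, α > 0, β > 0 be reals. Then ∫ F·G dμ ≤ exp(−L²/(D(α+β))) · (∫ F² · exp(2a²/(Dα)) dμ)^{1/2} · (∫ G² · exp(2b²/(Dβ)) dμ)^{1/2}, where the integrals are taken in the extended nonnegative reals. -/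
open MeasureTheory ENNReal

theorem add_sq_div_add_le_sq_div_add_sq_div {x y α β : ℝ} (hα : 0 < α) (hβ : 0 < β) :
    (x + y) ^ 2 / (α + β) ≤ x ^ 2 / α + y ^ 2 / β := by
  have h : x ^ 2 / α + y ^ 2 / β - (x + y) ^ 2 / (α + β) =
      (x * β - y * α) ^ 2 / (α * β * (α + β)) := by
    field_simp
    ring
  have h_nonneg : 0 ≤ (x * β - y * α) ^ 2 / (α * β * (α + β)) := by positivity
  linarith

theorem one_le_exp_neg_mul_exp_mul_exp {x y L D α β : ℝ} (hL : 0 ≤ L) (hxy : L ≤ x + y)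
    (hD : 0 < D) (hα : 0 < α) (hβ : 0 < β) :
    1 ≤ Real.exp (-(L ^ 2) / (D * (α + β))) *
      (Real.exp (x ^ 2 / (D * α)) * Real.exp (y ^ 2 / (D * β))) := by
  rw [← Real.exp_add, ← Real.exp_add, Real.one_le_exp_iff, neg_div]
  have hsum : (x + y) ^ 2 / (D * (α + β)) ≤ x ^ 2 / (D * α) + y ^ 2 / (D * β) := by
    rw [mul_add]
    exact add_sq_div_add_le_sq_div_add_sq_div (by positivity) (by positivity)
  have hmono : L ^ 2 / (D * (α + β)) ≤ (x + y) ^ 2 / (D * (α + β)) := by gcongr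
  linarith

theorem ofReal_mul_exp_rpow_two {x : ℝ} (hx : 0 ≤ x) (s t : ℝ) :
    ENNReal.ofReal (x * Real.exp (s ^ 2 / t)) ^ (2 : ℝ) =
      ENNReal.ofReal (x ^ 2 * Real.exp (2 * s ^ 2 / t)) := by
  rw [ENNReal.ofReal_rpow_of_nonneg (by positivity) zero_le_two, Real.rpow_two, mul_pow,
    ← Real.exp_nat_mul, Nat.cast_ofNat, mul_div_assoc]

theorem stmt_14 {Z : Type*} [MeasurableSpace Z] (μ : Measure Z)
    (F G a b : Z → ℝ)
    (hF : Measurable F) (hG : Measurable G)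
    (ha : Measurable a) (hb : Measurable b)
    (hFpos : ∀ z, 0 ≤ F z) (hGpos : ∀ z, 0 ≤ G z)
    (hapos : ∀ z, 0 ≤ a z) (hbpos : ∀ z, 0 ≤ b z)
    (L : ℝ) (hL : 0 ≤ L) (hab : ∀ z, L ≤ a z + b z)
    (D α β : ℝ) (hD : 0 < D) (hα : 0 < α) (hβ : 0 < β) :
    ∫⁻ z, ENNReal.ofReal (F z * G z) ∂μ ≤
      ENNReal.ofReal (Real.exp (-(L ^ 2) / (D * (α + β)))) *
        (∫⁻ z, ENNReal.ofReal (F z ^ 2 * Real.exp (2 * a z ^ 2 / (D * α))) ∂μ) ^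
          (1 / 2 : ℝ) *
        (∫⁻ z, ENNReal.ofReal (G z ^ 2 * Real.exp (2 * b z ^ 2 / (D * β))) ∂μ) ^
          (1 / 2 : ℝ) := by
  have hHolder := ENNReal.lintegral_mul_le_Lp_mul_Lq μ Real.HolderConjugate.two_two
    (f := fun z => ENNReal.ofReal (F z * Real.exp (a z ^ 2 / (D * α))))
    (g := fun z => ENNReal.ofReal (G z * Real.exp (b z ^ 2 / (D * β))))
    (by fun_prop) (by fun_prop)
  simp only [ofReal_mul_exp_rpow_two (hFpos _), ofReal_mul_exp_rpow_two (hGpos _)] at hHolder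
  rw [mul_assoc]
  refine le_trans ?_ (mul_le_mul_right hHolder _)
  rw [← lintegral_const_mul' _ _ ENNReal.ofReal_ne_top]
  refine lintegral_mono fun z => ?_
  have hF_exp : 0 ≤ F z * Real.exp (a z ^ 2 / (D * α)) := mul_nonneg (hFpos z) (Real.exp_nonneg _)
  rw [Pi.mul_apply, ← ENNReal.ofReal_mul hF_exp, ← ENNReal.ofReal_mul (Real.exp_nonneg _)]
  refine ENNReal.ofReal_le_ofReal ?_
  have h := le_mul_of_one_le_right (mul_nonneg (hFpos z) (hGpos z))
    (one_le_exp_neg_mul_exp_mul_exp hL (hab z) hD hα hβ)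
  exact h.trans_eq (by ring)
end

section
/- Let γ > 1 be a real number and n ≥ 1 a natural number. Then there exist constants C₁ > 0 and C₂ > 0 (depending only on γ and n) such that for every real ξ ≥ 1, ∑_{k=0}^∞ γ^{(k+1)n/2} · exp(−2ξ · γ^{k+1}/((γ−1)(k+2)²(k+3)²)) ≤ C₁ · exp(−C₂ · ξ). -/
open Filter Topology in
/-- Exponential growth beats the quartic denominator, even after dividing by `k + 1`. -/
theorem tendsto_succ_mul_quartic_div_pow {γ : ℝ} (hγ : 1 < γ) :
    Tendsto (fun k : ℕ => ((k : ℝ) + 1) *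
      (((γ - 1) * ((k : ℝ) + 2) ^ 2 * ((k : ℝ) + 3) ^ 2) / γ ^ (k + 1))) atTop (𝓝 0) := by
  have hγ' : 0 < γ - 1 := sub_pos.2 hγ
  have hγ0 : 0 < γ := one_pos.trans hγ
  have h := (((tendsto_pow_const_div_const_pow_of_one_lt 5 hγ).comp
    (tendsto_add_atTop_nat 1)).const_mul (36 * (γ - 1)))
  rw [mul_zero] at h
  refine squeeze_zero (fun k => by positivity) (fun k => ?_) h
  have hk : (0 : ℝ) ≤ k := k.cast_nonneg
  have h2 : ((k : ℝ) + 2) ^ 2 ≤ (2 * (k + 1)) ^ 2 := by gcongr; linarith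
  have h3 : ((k : ℝ) + 3) ^ 2 ≤ (3 * (k + 1)) ^ 2 := by gcongr; linarith
  calc ((k : ℝ) + 1) * (((γ - 1) * ((k : ℝ) + 2) ^ 2 * ((k : ℝ) + 3) ^ 2) / γ ^ (k + 1))
      ≤ ((k : ℝ) + 1) * (((γ - 1) * (2 * ((k : ℝ) + 1)) ^ 2 * (3 * ((k : ℝ) + 1)) ^ 2)
          / γ ^ (k + 1)) := by gcongr
    _ = _ := by
      simp only [Function.comp_apply]
      push_cast
      ring

open Filter Topology in
/-- If `a k` is positive and grows superlinearly, then `∑ exp (l * (k + 1) - ξ * a k)` converges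
for `ξ ≥ 1` and decays exponentially in `ξ`. -/
theorem exists_tsum_exp_sub_mul_le {a : ℕ → ℝ} (ha : ∀ k, 0 < a k)
    (hlim : Tendsto (fun k : ℕ => ((k : ℝ) + 1) * (a k)⁻¹) atTop (𝓝 0)) {l : ℝ} (hl : 0 ≤ l) :
    ∃ C₁ : ℝ, 0 < C₁ ∧ ∃ C₂ : ℝ, 0 < C₂ ∧ ∀ ξ : ℝ, 1 ≤ ξ →
      Summable (fun k : ℕ => Real.exp (l * (k + 1) - ξ * a k)) ∧
      ∑' k : ℕ, Real.exp (l * (k + 1) - ξ * a k) ≤ C₁ * Real.exp (-C₂ * ξ) := by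
  obtain ⟨c, hc, hca⟩ : ∃ c : ℝ, 0 < c ∧ ∀ k, c ≤ a k := by
    obtain ⟨B, hB⟩ := hlim.bddAbove_range
    have hB' : ∀ k : ℕ, ((k : ℝ) + 1) * (a k)⁻¹ ≤ B := fun k => hB ⟨k, rfl⟩
    have hB0 : 0 < B := lt_of_lt_of_le (by have := ha 0; positivity) (hB' 0)
    refine ⟨B⁻¹, inv_pos.2 hB0, fun k => ?_⟩
    rw [inv_le_comm₀ hB0 (ha k)]
    refine le_trans (le_mul_of_one_le_left (inv_pos.2 (ha k)).le ?_) (hB' k)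
    linarith [k.cast_nonneg (α := ℝ)]
  have hsum : Summable (fun k : ℕ => Real.exp (l * (k + 1) - a k)) := by
    refine Summable.of_norm_bounded_eventually_nat Real.summable_exp_neg_nat ?_
    have hL : 0 < l + 1 := by linarith
    filter_upwards [hlim.eventually (ge_mem_nhds (inv_pos.2 hL))] with k hk
    rw [Real.norm_of_nonneg (Real.exp_pos _).le, Real.exp_le_exp]
    rw [← div_eq_mul_inv, div_le_iff₀ (ha k), inv_mul_eq_div, le_div_iff₀ hL] at hk
    linarith
  have hle : ∀ ξ : ℝ, 1 ≤ ξ → ∀ k : ℕ, Real.exp (l * (k + 1) - ξ * a k) ≤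
      Real.exp (l * (k + 1) - a k) * Real.exp (c - c * ξ) := by
    intro ξ hξ k
    rw [← Real.exp_add, Real.exp_le_exp]
    nlinarith [mul_nonneg (sub_nonneg.2 hξ) (sub_nonneg.2 (hca k))]
  refine ⟨(∑' k : ℕ, Real.exp (l * (k + 1) - a k)) * Real.exp c,
    mul_pos (hsum.tsum_pos (fun _ => (Real.exp_pos _).le) 0 (Real.exp_pos _)) (Real.exp_pos _),
    c, hc, fun ξ hξ => ?_⟩
  have hs := Summable.of_nonneg_of_le (fun _ => (Real.exp_pos _).le) (hle ξ hξ)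
    (hsum.mul_right _)
  refine ⟨hs, (hs.tsum_le_tsum (hle ξ hξ) (hsum.mul_right _)).trans_eq ?_⟩
  rw [tsum_mul_right, mul_assoc, ← Real.exp_add, neg_mul, sub_eq_add_neg]

theorem stmt_16 (γ : ℝ) (hγ : 1 < γ) (n : ℕ) (hn : 1 ≤ n) :
    ∃ C₁ : ℝ, 0 < C₁ ∧ ∃ C₂ : ℝ, 0 < C₂ ∧
      ∀ ξ : ℝ, 1 ≤ ξ →
        Summable (fun k : ℕ =>
          γ ^ (((k : ℝ) + 1) * n / 2) *
            Real.exp (-2 * ξ * γ ^ (k + 1) /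
              ((γ - 1) * ((k : ℝ) + 2) ^ 2 * ((k : ℝ) + 3) ^ 2))) ∧
        ∑' k : ℕ,
            γ ^ (((k : ℝ) + 1) * n / 2) *
              Real.exp (-2 * ξ * γ ^ (k + 1) /
                ((γ - 1) * ((k : ℝ) + 2) ^ 2 * ((k : ℝ) + 3) ^ 2)) ≤
          C₁ * Real.exp (-C₂ * ξ) := by
  have hγ' : 0 < γ - 1 := sub_pos.2 hγ
  have hγ0 : 0 < γ := one_pos.trans hγ
  have hlim := (tendsto_succ_mul_quartic_div_pow hγ).const_mul (1 / 2)
  rw [mul_zero] at hlim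
  have key := exists_tsum_exp_sub_mul_le
    (a := fun k : ℕ => 2 * (γ ^ (k + 1) / ((γ - 1) * ((k : ℝ) + 2) ^ 2 * ((k : ℝ) + 3) ^ 2)))
    (fun k => by positivity)
    (hlim.congr fun k => by rw [mul_inv, inv_div]; ring)
    (l := Real.log γ * n / 2) (by have := Real.log_pos hγ; positivity)
  have hterm : ∀ (ξ : ℝ) (k : ℕ), γ ^ (((k : ℝ) + 1) * n / 2) *
      Real.exp (-2 * ξ * γ ^ (k + 1) / ((γ - 1) * ((k : ℝ) + 2) ^ 2 * ((k : ℝ) + 3) ^ 2)) =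
      Real.exp (Real.log γ * n / 2 * (k + 1) -
        ξ * (2 * (γ ^ (k + 1) / ((γ - 1) * ((k : ℝ) + 2) ^ 2 * ((k : ℝ) + 3) ^ 2)))) := by
    intro ξ k
    rw [Real.rpow_def_of_pos hγ0, ← Real.exp_add]
    ring_nf
  simpa only [hterm] using key
end
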